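/- arXiv:1404.1273 — 2 statements merged into one kernel-verified Lean document; each statement's English description precedes it below -/
import Mathlib

section
/- Let X = (Ω, ℱ, ℙ, τ) be a metric dynamical system, V a potential on Ω and c ≥ 0 a constant. Then for every y ∈ ℝ^d one has Γ_{c+V}(y)² ≥ Γ_V(y)² + Γ_c(y)², i.e. Γ_{c+V}(y)² ≥ Γ_V(y)² + 2c|y|². -/
open MeasureTheory Filter

noncomputable section

/-- `ℝ^d` with the Euclidean norm. -/
abbrev Rd (d : ℕ) := EuclideanSpace ℝ (Fin d)

variable {d : ℕ} {Ω : Type*} [MeasurableSpace Ω]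

/-- The realisation `f_ω : ℝ^d → E`, `f_ω(x) = f(τ_x ω)`. -/
def realise (τ : Rd d → Ω → Ω) {E : Type*} (f : Ω → E) (ω : Ω) : Rd d → E :=
  fun x => f (τ x ω)

/-- `(Ω, ℱ, ℙ, τ)` is a metric dynamical system: `ℙ` is a probability measure, `τ` is a
jointly measurable action of `(ℝ^d, +)` on `Ω` leaving `ℙ` invariant. -/
def IsMDS (P : Measure Ω) (τ : Rd d → Ω → Ω) : Prop :=
  IsProbabilityMeasure P ∧ Measurable (Function.uncurry τ) ∧
    (∀ x y ω, τ (x + y) ω = τ x (τ y ω)) ∧ (∀ ω, τ 0 ω = ω) ∧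
    ∀ x, MeasurePreserving (τ x) P P

/-- A potential: a nonnegative function in `L¹(ℙ)`. -/
def IsPotential (P : Measure Ω) (V : Ω → ℝ) : Prop :=
  Measurable V ∧ (∀ ω, 0 ≤ V ω) ∧ Integrable V P

/-- The space `𝔽`: probability densities `f ∈ L¹(ℙ)` with `𝔼f = 1`, bounded away from `0`,
all realisations smooth, and `sup_Ω |Dⁿf| < ∞` for all `n`. -/
def memF (P : Measure Ω) (τ : Rd d → Ω → Ω) (f : Ω → ℝ) : Prop :=
  Measurable f ∧ Integrable f P ∧ (∫ ω, f ω ∂P) = 1 ∧ (∃ c > 0, ∀ ω, c ≤ f ω) ∧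
    (∀ ω, ContDiff ℝ (⊤ : ℕ∞) (realise τ f ω)) ∧
    (∀ n : ℕ, ∃ C, ∀ ω, ‖iteratedFDeriv ℝ n (realise τ f ω) 0‖ ≤ C)

/-- The space `Φ_y`: vector fields `φ ∈ (L¹(ℙ))^d` with smooth realisations, all derivatives
uniformly bounded, `𝔼φ = y`, and divergence-free realisations. -/
def memPhi (P : Measure Ω) (τ : Rd d → Ω → Ω) (y : Rd d) (φ : Ω → Rd d) : Prop :=
  Measurable φ ∧ Integrable φ P ∧ (∫ ω, φ ω ∂P) = y ∧
    (∀ ω, ContDiff ℝ (⊤ : ℕ∞) (realise τ φ ω)) ∧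
    (∀ n : ℕ, ∃ C, ∀ ω, ‖iteratedFDeriv ℝ n (realise τ φ ω) 0‖ ≤ C) ∧
    (∀ ω x, (∑ i, fderiv ℝ (fun z => realise τ φ ω z i) x (EuclideanSpace.single i 1)) = 0)

/-- The energy term `∫ (|∇f|²/(8f) + Vf) dℙ`. -/
def energy (P : Measure Ω) (τ : Rd d → Ω → Ω) (V f : Ω → ℝ) : ℝ :=
  ∫ ω, (‖fderiv ℝ (realise τ f ω) 0‖ ^ 2 / (8 * f ω) + V ω * f ω) ∂P

/-- The transport term `inf_{φ ∈ Φ_y} ∫ |φ|²/(2f) dℙ`. -/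
def transport (P : Measure Ω) (τ : Rd d → Ω → Ω) (f : Ω → ℝ) (y : Rd d) : ℝ :=
  sInf {r | ∃ φ, memPhi P τ y φ ∧ r = ∫ ω, ‖φ ω‖ ^ 2 / (2 * f ω) ∂P}

/-- The variational functional
`Γ_V(y) = 2 inf_{f ∈ 𝔽} [ (∫ |∇f|²/(8f) + Vf dℙ) (inf_{φ ∈ Φ_y} ∫ |φ|²/(2f) dℙ) ]^{1/2}`. -/
def Gamma (P : Measure Ω) (τ : Rd d → Ω → Ω) (V : Ω → ℝ) (y : Rd d) : ℝ :=
  2 * sInf {r | ∃ f, memF P τ f ∧ r = Real.sqrt (energy P τ V f * transport P τ f y)}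

end

theorem measurable_norm_fderiv_realise {d : ℕ} {Ω : Type*} [MeasurableSpace Ω]
    {P : Measure Ω} {τ : Rd d → Ω → Ω} (hX : IsMDS P τ) {f : Ω → ℝ} (hf : memF P τ f) :
    Measurable (fun ω => ‖fderiv ℝ (realise τ f ω) 0‖) := by
  obtain ⟨hP, -, -, h0, hτ⟩ := hX
  obtain ⟨hfm, -, -, -, hsm, -⟩ := hf
  have hdir : ∀ v : Rd d, Measurable (fun ω => fderiv ℝ (realise τ f ω) 0 v) := by
    intro v
    refine measurable_of_tendsto_metrizable
      (f := fun (n : ℕ) ω => (n : ℝ) • (f (τ (0 + (n : ℝ)⁻¹ • v) ω) - f (τ 0 ω))) ?_ ?_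
    · intro n
      have h1 := hfm.comp (hτ (0 + (n : ℝ)⁻¹ • v)).measurable
      have h2 := hfm.comp (hτ 0).measurable
      exact (h1.sub h2).const_smul (n : ℝ)
    · rw [tendsto_pi_nhds]
      intro ω
      have hd : HasFDerivAt (realise τ f ω) (fderiv ℝ (realise τ f ω) 0) 0 :=
        (((hsm ω).differentiable (by simp)) 0).hasFDerivAt
      exact (hd.lim_real v).comp tendsto_natCast_atTop_atTop
  have hg : Continuous (fun v : Fin d → ℝ =>
      ‖∑ i, v i • (EuclideanSpace.proj i : Rd d →L[ℝ] ℝ)‖) := by fun_prop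
  have heq : (fun ω => ‖fderiv ℝ (realise τ f ω) 0‖) = fun ω =>
      (fun v : Fin d → ℝ => ‖∑ i, v i • (EuclideanSpace.proj i : Rd d →L[ℝ] ℝ)‖)
        (fun i => fderiv ℝ (realise τ f ω) 0 (EuclideanSpace.single i 1)) := by
    funext ω
    simp only
    congr 1
    ext x
    have hx : x = ∑ i, x i • EuclideanSpace.single i (1 : ℝ) := by
      have := (EuclideanSpace.basisFun (Fin d) ℝ).sum_repr x
      simpa using this.symm
    conv_lhs => rw [hx]
    simp [map_sum, mul_comm]
  rw [heq]
  exact hg.measurable.comp (measurable_pi_iff.2 fun i => hdir _)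

theorem memF_bound {d : ℕ} {Ω : Type*} [MeasurableSpace Ω]
    {P : Measure Ω} {τ : Rd d → Ω → Ω} (hX : IsMDS P τ) {f : Ω → ℝ} (hf : memF P τ f) :
    ∃ C, ∀ ω, ‖f ω‖ ≤ C := by
  obtain ⟨C, hC⟩ := hf.2.2.2.2.2 0
  refine ⟨C, fun ω => ?_⟩
  have := hC ω
  rw [norm_iteratedFDeriv_zero] at this
  simpa [realise, hX.2.2.2.1 ω] using this

theorem integrable_grad {d : ℕ} {Ω : Type*} [MeasurableSpace Ω]
    {P : Measure Ω} {τ : Rd d → Ω → Ω} (hX : IsMDS P τ) {f : Ω → ℝ} (hf : memF P τ f) :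
    Integrable (fun ω => ‖fderiv ℝ (realise τ f ω) 0‖ ^ 2 / (8 * f ω)) P := by
  have hm := measurable_norm_fderiv_realise hX hf
  have := hX.1
  obtain ⟨hfm, -, -, ⟨a, ha, hfa⟩, -, hb⟩ := hf
  obtain ⟨C, hC⟩ := hb 1
  refine Integrable.of_bound
    ((hm.pow_const 2).div (hfm.const_mul 8)).aestronglyMeasurable (C ^ 2 / (8 * a)) ?_
  refine Eventually.of_forall fun ω => ?_
  have h1 := hC ω
  rw [norm_iteratedFDeriv_one] at h1
  have h2 := hfa ω
  have h3 := ha.trans_le h2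
  rw [Real.norm_of_nonneg (by positivity)]
  gcongr

theorem energy_add_const {d : ℕ} {Ω : Type*} [MeasurableSpace Ω]
    {P : Measure Ω} {τ : Rd d → Ω → Ω} (hX : IsMDS P τ) {f : Ω → ℝ} (hf : memF P τ f)
    {V : Ω → ℝ} (hV : IsPotential P V) (c : ℝ) :
    energy P τ (fun ω => c + V ω) f = energy P τ V f + c := by
  have hg := integrable_grad hX hf
  obtain ⟨C, hC⟩ := memF_bound hX hf
  have hVf : Integrable (fun ω => V ω * f ω) P :=
    hV.2.2.mul_bdd (c := C) hf.1.aestronglyMeasurable (Eventually.of_forall hC)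
  have hcf : Integrable (fun ω => c * f ω) P := hf.2.1.const_mul c
  have h1 : ∫ ω, c * f ω ∂P = c := by rw [integral_const_mul, hf.2.2.1, mul_one]
  unfold energy
  conv_rhs => rw [← h1]
  refine Eq.trans ?_ (integral_add (hg.add hVf) hcf)
  refine integral_congr_ae (Eventually.of_forall fun ω => ?_)
  simp only [Pi.add_apply]
  ring

theorem energy_nonneg {d : ℕ} {Ω : Type*} [MeasurableSpace Ω]
    {P : Measure Ω} {τ : Rd d → Ω → Ω} {f : Ω → ℝ} (hf : memF P τ f)
    {V : Ω → ℝ} (hV : ∀ ω, 0 ≤ V ω) : 0 ≤ energy P τ V f := by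
  obtain ⟨a, ha, hfa⟩ := hf.2.2.2.1
  refine integral_nonneg fun ω => ?_
  have h1 : 0 < f ω := ha.trans_le (hfa ω)
  have h2 := hV ω
  simp only [Pi.zero_apply]
  positivity

theorem memPhi_const {d : ℕ} {Ω : Type*} [MeasurableSpace Ω]
    {P : Measure Ω} {τ : Rd d → Ω → Ω} (hX : IsMDS P τ) (y : Rd d) :
    memPhi P τ y (fun _ => y) := by
  have := hX.1
  refine ⟨measurable_const, integrable_const _, by simp, fun ω => contDiff_const, ?_, ?_⟩
  · intro n
    exact ⟨‖iteratedFDeriv ℝ n (fun _ : Rd d => y) 0‖, fun ω => le_rfl⟩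
  · intro ω x
    simp [realise]

theorem memF_one {d : ℕ} {Ω : Type*} [MeasurableSpace Ω]
    {P : Measure Ω} {τ : Rd d → Ω → Ω} (hX : IsMDS P τ) :
    memF P τ (fun _ => 1) := by
  have := hX.1
  refine ⟨measurable_const, integrable_const _, by simp, ⟨1, one_pos, fun _ => le_rfl⟩,
    fun ω => contDiff_const, ?_⟩
  intro n
  exact ⟨‖iteratedFDeriv ℝ n (fun _ : Rd d => (1 : ℝ)) 0‖, fun ω => le_rfl⟩

theorem transport_ge {d : ℕ} {Ω : Type*} [MeasurableSpace Ω]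
    {P : Measure Ω} {τ : Rd d → Ω → Ω} (hX : IsMDS P τ) {f : Ω → ℝ} (hf : memF P τ f)
    (y : Rd d) : ‖y‖ ^ 2 / 2 ≤ transport P τ f y := by
  have := hX.1
  obtain ⟨hfm, hfi, hf1, ⟨a, ha, hfa⟩, -, -⟩ := hf
  refine le_csInf ⟨_, _, memPhi_const hX y, rfl⟩ ?_
  rintro r ⟨φ, ⟨hφm, hφi, hφy, -, hφb, -⟩, rfl⟩
  obtain ⟨C, hC⟩ := hφb 0
  have hint : Integrable (fun ω => ‖φ ω‖ ^ 2 / (2 * f ω)) P := by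
    refine Integrable.of_bound
      ((hφm.norm.pow_const 2).div (hfm.const_mul 2)).aestronglyMeasurable (C ^ 2 / (2 * a)) ?_
    refine Eventually.of_forall fun ω => ?_
    have h1 := hC ω
    rw [norm_iteratedFDeriv_zero] at h1
    simp only [realise, hX.2.2.2.1 ω] at h1
    have h2 := hfa ω
    have h3 := ha.trans_le h2
    rw [Real.norm_of_nonneg (by positivity)]
    gcongr
  have hle : ∫ ω, ‖y‖ * ‖φ ω‖ ∂P ≤ ∫ ω, (‖φ ω‖ ^ 2 / (2 * f ω) + ‖y‖ ^ 2 / 2 * f ω) ∂P := by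
    refine integral_mono (hφi.norm.const_mul _) (hint.add (hfi.const_mul _)) fun ω => ?_
    have h3 := ha.trans_le (hfa ω)
    have : ‖φ ω‖ ^ 2 / (2 * f ω) + ‖y‖ ^ 2 / 2 * f ω - ‖y‖ * ‖φ ω‖
        = (‖φ ω‖ - ‖y‖ * f ω) ^ 2 / (2 * f ω) := by
      field_simp
      ring
    have h4 : 0 ≤ (‖φ ω‖ - ‖y‖ * f ω) ^ 2 / (2 * f ω) := by positivity
    simp only
    linarith
  rw [integral_add hint (hfi.const_mul _), integral_const_mul, integral_const_mul, hf1] at hle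
  have hy : ‖y‖ ≤ ∫ ω, ‖φ ω‖ ∂P := by
    conv_lhs => rw [← hφy]
    exact norm_integral_le_integral_norm _
  have := mul_le_mul_of_nonneg_left hy (norm_nonneg y)
  nlinarith

theorem Gamma_nonneg' {d : ℕ} {Ω : Type*} [MeasurableSpace Ω]
    (P : Measure Ω) (τ : Rd d → Ω → Ω) (V : Ω → ℝ) (y : Rd d) : 0 ≤ Gamma P τ V y := by
  refine mul_nonneg (by norm_num) (Real.sInf_nonneg ?_)
  rintro r ⟨f, -, rfl⟩
  exact Real.sqrt_nonneg _

theorem Gamma_sq_le {d : ℕ} {Ω : Type*} [MeasurableSpace Ω]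
    {P : Measure Ω} {τ : Rd d → Ω → Ω} (hX : IsMDS P τ) {f : Ω → ℝ} (hf : memF P τ f)
    {V : Ω → ℝ} (hV : ∀ ω, 0 ≤ V ω) (y : Rd d) :
    (Gamma P τ V y) ^ 2 ≤ 4 * (energy P τ V f * transport P τ f y) := by
  have hT : 0 ≤ transport P τ f y := le_trans (by positivity) (transport_ge hX hf y)
  have hE := energy_nonneg hf hV
  have h1 : Gamma P τ V y ≤ 2 * Real.sqrt (energy P τ V f * transport P τ f y) := by
    refine mul_le_mul_of_nonneg_left (csInf_le ⟨0, ?_⟩ ⟨f, hf, rfl⟩) (by norm_num)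
    rintro r ⟨f, -, rfl⟩
    exact Real.sqrt_nonneg _
  have h2 := pow_le_pow_left₀ (Gamma_nonneg' P τ V y) h1 2
  rw [mul_pow, Real.sq_sqrt (mul_nonneg hE hT)] at h2
  linarith

theorem Gamma_const_sq_le {d : ℕ} {Ω : Type*} [MeasurableSpace Ω]
    {P : Measure Ω} {τ : Rd d → Ω → Ω} (hX : IsMDS P τ) {c : ℝ} (hc : 0 ≤ c) (y : Rd d) :
    (Gamma P τ (fun _ => c) y) ^ 2 ≤ 2 * c * ‖y‖ ^ 2 := by
  have := hX.1
  have h := Gamma_sq_le hX (memF_one hX) (V := fun _ => c) (fun _ => hc) y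
  have hE : energy P τ (fun _ => c) (fun _ => 1) = c := by
    have h0 : ∀ ω, realise τ (fun _ : Ω => (1 : ℝ)) ω = fun _ => 1 := fun _ => rfl
    simp [energy, h0]
  have hT : transport P τ (fun _ => 1) y ≤ ‖y‖ ^ 2 / 2 := by
    refine csInf_le ⟨0, ?_⟩ ⟨_, memPhi_const hX y, by simp⟩
    rintro r ⟨φ, -, rfl⟩
    exact integral_nonneg fun ω => by simp only [Pi.zero_apply]; positivity
  rw [hE] at h
  have := mul_le_mul_of_nonneg_left hT hc
  linarith

/-- `Γ_{c+V}(y)² ≥ Γ_V(y)² + Γ_c(y)²`, i.e. `Γ_{c+V}(y)² ≥ Γ_V(y)² + 2c|y|²`. -/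
theorem gamma_add_const {d : ℕ} {Ω : Type*} [MeasurableSpace Ω]
    (P : Measure Ω) (τ : Rd d → Ω → Ω) (hX : IsMDS P τ)
    (V : Ω → ℝ) (hV : IsPotential P V) (c : ℝ) (hc : 0 ≤ c) (y : Rd d) :
    (Gamma P τ V y) ^ 2 + (Gamma P τ (fun _ => c) y) ^ 2 ≤
        (Gamma P τ (fun ω => c + V ω) y) ^ 2 ∧
    (Gamma P τ V y) ^ 2 + 2 * c * ‖y‖ ^ 2 ≤
        (Gamma P τ (fun ω => c + V ω) y) ^ 2 := by
  have key : (Gamma P τ V y) ^ 2 + 2 * c * ‖y‖ ^ 2 ≤ (Gamma P τ (fun ω => c + V ω) y) ^ 2 := by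
    set A := (Gamma P τ V y) ^ 2 + 2 * c * ‖y‖ ^ 2 with hA
    have hA0 : 0 ≤ A := by positivity
    have h1 : Real.sqrt (A / 4) ≤
        sInf {r | ∃ f, memF P τ f ∧
          r = Real.sqrt (energy P τ (fun ω => c + V ω) f * transport P τ f y)} := by
      refine le_csInf ⟨_, _, memF_one hX, rfl⟩ ?_
      rintro r ⟨f, hf, rfl⟩
      refine Real.sqrt_le_sqrt ?_
      rw [energy_add_const hX hf hV c]
      have h2 := Gamma_sq_le hX hf hV.2.1 y
      have h3 := mul_le_mul_of_nonneg_left (transport_ge hX hf y) hc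
      rw [hA]
      linarith
    have h4 : 2 * Real.sqrt (A / 4) ≤ Gamma P τ (fun ω => c + V ω) y :=
      mul_le_mul_of_nonneg_left h1 (by norm_num)
    have h5 := pow_le_pow_left₀ (by positivity) h4 2
    rw [mul_pow, Real.sq_sqrt (by positivity)] at h5
    linarith
  exact ⟨by linarith [Gamma_const_sq_le hX hc y (P := P) (τ := τ)], key⟩
end

section
/- Let X = (Ω, ℱ, ℙ, τ) and Y = (Ω, 𝒢, ℙ|_𝒢, τ) be metric dynamical systems with 𝒢 ⊂ ℱ a sub-σ-algebra (in particular τ is 𝒢-measurable and preserves ℙ|_𝒢), and let V be a potential on X. Then for every y ∈ ℝ^d, Γ_V^X(y) ≤ Γ_{𝔼[V|𝒢]}^Y(y), where Γ^X and Γ^Y denote the variational functional computed with the function spaces 𝔽, Φ_y of X and of Y respectively, and 𝔼[V|𝒢] is the conditional expectation of V given 𝒢. -/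
open MeasureTheory Filter

lemma aux_grad_meas {d : ℕ} {Ω : Type*} [MeasurableSpace Ω] (τ : Rd d → Ω → Ω)
    (hτ : Measurable (Function.uncurry τ)) (h0 : ∀ ω, τ 0 ω = ω)
    (f : Ω → ℝ) (hf : Measurable f)
    (hs : ∀ ω, ContDiff ℝ (⊤ : ℕ∞) (realise τ f ω)) :
    Measurable (fun ω => ‖fderiv ℝ (realise τ f ω) 0‖) := by
  have hx : ∀ x, Measurable (τ x) := fun x => hτ.comp (measurable_const.prodMk measurable_id)
  have hv : ∀ v : Rd d, Measurable (fun ω => fderiv ℝ (realise τ f ω) 0 v) := by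
    intro v
    refine measurable_of_tendsto_metrizable
      (f := fun (n : ℕ) ω => (n : ℝ) • (f (τ ((n : ℝ)⁻¹ • v) ω) - f ω)) ?_ ?_
    · intro n
      simp only [smul_eq_mul]
      exact ((hf.comp (hx _)).sub hf).const_mul _
    · rw [tendsto_pi_nhds]
      intro ω
      have hd : HasFDerivAt (realise τ f ω) (fderiv ℝ (realise τ f ω) 0) 0 :=
        ((hs ω).differentiable (by simp)).differentiableAt.hasFDerivAt
      have := hd.lim v (c := fun n : ℕ => (n : ℝ)) (l := atTop)
        (by simpa using tendsto_natCast_atTop_atTop (R := ℝ))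
      simpa [realise, h0] using this
  have he : ∀ ω, fderiv ℝ (realise τ f ω) 0 = ∑ i : Fin d,
      (fderiv ℝ (realise τ f ω) 0 (EuclideanSpace.single i 1)) •
        (EuclideanSpace.proj i : Rd d →L[ℝ] ℝ) := by
    intro ω
    ext v
    conv_lhs => rw [← (EuclideanSpace.basisFun (Fin d) ℝ).sum_repr v]
    simp [mul_comm]
  have hc : Continuous (fun a : Fin d → ℝ =>
      ‖∑ i : Fin d, a i • (EuclideanSpace.proj i : Rd d →L[ℝ] ℝ)‖) := by fun_prop
  have := hc.measurable.comp (measurable_pi_lambda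
    (fun ω i => fderiv ℝ (realise τ f ω) 0 (EuclideanSpace.single i 1)) (fun i => hv _))
  convert this using 1
  funext ω
  simp only [Function.comp]
  rw [← he ω]

lemma aux_memF {d : ℕ} {Ω : Type*} {m m0 : MeasurableSpace Ω} (hm : m ≤ m0)
    (P : @Measure Ω m0) (τ : Rd d → Ω → Ω) (f : Ω → ℝ)
    (hf : @memF d Ω m (P.trim hm) τ f) : @memF d Ω m0 P τ f := by
  obtain ⟨h1, h2, h3, h4⟩ := hf
  refine ⟨h1.mono hm le_rfl, integrable_of_integrable_trim hm h2, ?_, h4⟩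
  rw [← h3]
  exact integral_trim hm h1.stronglyMeasurable

lemma aux_memPhi {d : ℕ} {Ω : Type*} {m m0 : MeasurableSpace Ω} (hm : m ≤ m0)
    (P : @Measure Ω m0) (τ : Rd d → Ω → Ω) (y : Rd d) (f : Ω → Rd d)
    (hf : @memPhi d Ω m (P.trim hm) τ y f) : @memPhi d Ω m0 P τ y f := by
  obtain ⟨h1, h2, h3, h4⟩ := hf
  refine ⟨h1.mono hm le_rfl, integrable_of_integrable_trim hm h2, ?_, h4⟩
  rw [← h3]
  exact integral_trim hm h1.stronglyMeasurable

lemma aux_const_memF {d : ℕ} {Ω : Type*} [MeasurableSpace Ω] (P : Measure Ω)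
    [IsProbabilityMeasure P] (τ : Rd d → Ω → Ω) : memF P τ (fun _ => 1) := by
  refine ⟨measurable_const, integrable_const _, by simp, ⟨1, one_pos, fun _ => le_rfl⟩,
    fun ω => contDiff_const, fun n => ?_⟩
  exact ⟨‖iteratedFDeriv ℝ n (fun _ : Rd d => (1 : ℝ)) 0‖, fun ω => le_rfl⟩

lemma aux_const_memPhi {d : ℕ} {Ω : Type*} [MeasurableSpace Ω] (P : Measure Ω)
    [IsProbabilityMeasure P] (τ : Rd d → Ω → Ω) (y : Rd d) : memPhi P τ y (fun _ => y) := by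
  refine ⟨measurable_const, integrable_const _, by simp,
    fun ω => contDiff_const, fun n => ?_, fun ω x => by simp [realise]⟩
  exact ⟨‖iteratedFDeriv ℝ n (fun _ : Rd d => y) 0‖, fun ω => le_rfl⟩

lemma aux_meas {d : ℕ} {Ω : Type*} [MeasurableSpace Ω] (f : Ω → ℝ) (hf : Measurable f)
    (φ : Ω → Rd d) (hφ : Measurable φ) : Measurable (fun ω => ‖φ ω‖ ^ 2 / (2 * f ω)) :=
  (hφ.norm.pow_const 2).div (hf.const_mul 2)

lemma aux_transport {d : ℕ} {Ω : Type*} {m m0 : MeasurableSpace Ω} (hm : m ≤ m0)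
    (P : @Measure Ω m0) (τ : Rd d → Ω → Ω) (hY : @IsMDS d Ω m (P.trim hm) τ) (y : Rd d)
    (f : Ω → ℝ) (hf : @memF d Ω m (P.trim hm) τ f) :
    @transport d Ω m0 P τ f y ≤ @transport d Ω m (P.trim hm) τ f y := by
  have := hY.1
  obtain ⟨h1, -, -, ⟨c, hc, hcf⟩, -⟩ := hf
  refine csInf_le_csInf ?_ ?_ ?_
  · refine ⟨0, ?_⟩
    rintro r ⟨φ, -, rfl⟩
    refine integral_nonneg fun ω => ?_
    have := hc.trans_le (hcf ω)
    change 0 ≤ _ / _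
    positivity
  · exact ⟨_, _, @aux_const_memPhi d Ω m (P.trim hm) _ τ y, rfl⟩
  · rintro r ⟨φ, hφ, rfl⟩
    refine ⟨φ, aux_memPhi hm P τ y φ hφ, ?_⟩
    have hφm := hφ.1
    exact (integral_trim hm
      (@aux_meas d Ω m f h1 φ hφm).stronglyMeasurable).symm

lemma aux_energy {d : ℕ} {Ω : Type*} {m m0 : MeasurableSpace Ω} (hm : m ≤ m0)
    (P : @Measure Ω m0) (τ : Rd d → Ω → Ω) (hX : @IsMDS d Ω m0 P τ)
    (hY : @IsMDS d Ω m (P.trim hm) τ)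
    (V : Ω → ℝ) (hV : @IsPotential Ω m0 P V)
    (f : Ω → ℝ) (hf : @memF d Ω m (P.trim hm) τ f) :
    @energy d Ω m0 P τ V f = @energy d Ω m (P.trim hm) τ (P[V|m]) f := by
  have := hX.1
  obtain ⟨h1, -, -, ⟨c, hc, hcf⟩, hs, hb⟩ := hf
  have hg : Measurable[m] (fun ω => ‖fderiv ℝ (realise τ f ω) 0‖ ^ 2 / (8 * f ω)) :=
    ((@aux_grad_meas d Ω m τ hY.2.1 hY.2.2.2.1 f h1 hs).pow_const 2).div (h1.const_mul 8)
  have hgi : Integrable (fun ω => ‖fderiv ℝ (realise τ f ω) 0‖ ^ 2 / (8 * f ω)) P := by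
    obtain ⟨C, hC⟩ := hb 1
    refine Integrable.of_bound (hg.mono hm le_rfl).aestronglyMeasurable (C ^ 2 / (8 * c))
      (Eventually.of_forall fun ω => ?_)
    have h := hC ω
    rw [norm_iteratedFDeriv_one] at h
    have := hc.trans_le (hcf ω)
    rw [Real.norm_of_nonneg (by positivity)]
    have := hcf ω
    gcongr
  obtain ⟨K, hK⟩ := hb 0
  have hfb : ∀ ω, ‖f ω‖ ≤ K := by
    intro ω
    have := hK ω
    rw [norm_iteratedFDeriv_zero] at this
    simpa [realise, hX.2.2.2.1] using this
  have hfm0 : AEStronglyMeasurable f P := (h1.mono hm le_rfl).aestronglyMeasurable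
  have hVf : Integrable (fun ω => V ω * f ω) P :=
    hV.2.2.mul_bdd (c := K) hfm0 (Eventually.of_forall hfb)
  have hEf : Integrable (fun ω => (P[V|m]) ω * f ω) P :=
    (integrable_condExp (μ := P) (m := m) (f := V)).mul_bdd (c := K) hfm0 (Eventually.of_forall hfb)
  have hkey : ∫ ω, (P[V|m]) ω * f ω ∂P = ∫ ω, V ω * f ω ∂P := by
    have h := condExp_mul_of_stronglyMeasurable_right (μ := P) (m := m) (f := V) (g := f)
      h1.stronglyMeasurable hVf hV.2.2
    rw [← integral_condExp hm (f := fun ω => V ω * f ω)]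
    exact (integral_congr_ae h).symm
  unfold energy
  rw [← integral_trim hm, integral_add hgi hVf, integral_add hgi hEf, hkey]
  exact hg.stronglyMeasurable.add (stronglyMeasurable_condExp.mul h1.stronglyMeasurable)

/-- for a sub-σ-algebra `𝒢 ⊂ ℱ`, `Γ_V^X ≤ Γ_{𝔼[V|𝒢]}^Y`. -/
theorem gamma_condexp {d : ℕ} {Ω : Type*} {m m0 : MeasurableSpace Ω} (hm : m ≤ m0)
    (P : @Measure Ω m0) (τ : Rd d → Ω → Ω)
    (hX : @IsMDS d Ω m0 P τ) (hY : @IsMDS d Ω m (P.trim hm) τ)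
    (V : Ω → ℝ) (hV : @IsPotential Ω m0 P V) (y : Rd d) :
    @Gamma d Ω m0 P τ V y ≤ @Gamma d Ω m (P.trim hm) τ (P[V|m]) y := by
  have := hY.1
  unfold Gamma
  refine mul_le_mul_of_nonneg_left ?_ zero_le_two
  refine le_csInf ⟨_, _, @aux_const_memF d Ω m (P.trim hm) _ τ, rfl⟩ ?_
  rintro r ⟨f, hf, rfl⟩
  refine le_trans (b := Real.sqrt (@energy d Ω m0 P τ V f * @transport d Ω m0 P τ f y))
    (csInf_le ⟨0, ?_⟩ ⟨f, aux_memF hm P τ f hf, rfl⟩) ?_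
  · rintro r ⟨f, -, rfl⟩
    exact Real.sqrt_nonneg _
  · rw [← aux_energy hm P τ hX hY V hV f hf]
    refine Real.sqrt_le_sqrt (mul_le_mul_of_nonneg_left (aux_transport hm P τ hY y f hf) ?_)
    obtain ⟨-, -, -, ⟨c, hc, hcf⟩, -⟩ := hf
    refine integral_nonneg fun ω => ?_
    have h1 := hc.trans_le (hcf ω)
    have h2 := hV.2.1 ω
    change 0 ≤ _ / _ + _ * _
    positivity
end
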